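/- Let k ≥ 1 be an integer, let P_0, P_1 ⊂ ℝ^{n−1} be (n−1)-dimensional polytopes, and let P := conv((P_0 × {0}) ∪ (P_1 × {k})) ⊂ ℝ^n be full-dimensional and simple, i.e., every vertex of P lies on exactly n edges. Then every vertex of P lies in P_0 × {0} or in P_1 × {k}, every vertex of P_0 × {0} lies on exactly one edge of P whose other endpoint lies in P_1 × {k}, and symmetrically every vertex of P_1 × {k} lies on exactly one edge of P whose other endpoint lies in P_0 × {0}; consequently P_0 and P_1 have the same number of vertices. -/

import Mathlib

open Set

/-- The real point corresponding to an integer lattice point. -/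
def toR {n : ℕ} (v : Fin n → ℤ) : Fin n → ℝ := fun i => (v i : ℝ)

/-- `P` is a lattice polytope: the convex hull of a finite set of integer points. -/
def IsLatticePolytope {n : ℕ} (P : Set (Fin n → ℝ)) : Prop :=
  ∃ S : Finset (Fin n → ℤ), P = convexHull ℝ (toR '' (S : Set (Fin n → ℤ)))

/-- `P` is full-dimensional: its affine span is everything. -/
def IsFullDim {n : ℕ} (P : Set (Fin n → ℝ)) : Prop :=
  affineSpan ℝ P = ⊤

/-- A vertex of `P` is an extreme point of `P`. -/
def IsVertex {n : ℕ} (P : Set (Fin n → ℝ)) (v : Fin n → ℝ) : Prop :=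
  v ∈ Set.extremePoints ℝ P

/-- The segment from `a` to `b` (distinct integer points) is an edge of `P`,
i.e. an exposed face of `P` which is a segment. -/
def IsEdge {n : ℕ} (P : Set (Fin n → ℝ)) (a b : Fin n → ℤ) : Prop :=
  a ≠ b ∧ IsExposed ℝ P (segment ℝ (toR a) (toR b))

/-- The lattice length of an integer vector: the gcd of its entries. -/
def latticeLength {n : ℕ} (v : Fin n → ℤ) : ℕ :=
  Finset.univ.gcd fun i => (v i).natAbs

/-- The primitive integer vector in the direction of `v`. -/
def primVec {n : ℕ} (v : Fin n → ℤ) : Fin n → ℤ :=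
  fun i => v i / (latticeLength v : ℤ)

/-- `P` is smooth at the integer vertex `v`: there are exactly `n` edges through `v`
and the primitive directions of these edges form a `ℤ`-basis of `ℤⁿ`. -/
def SmoothAtVertex {n : ℕ} (P : Set (Fin n → ℝ)) (v : Fin n → ℤ) : Prop :=
  ∃ b : Fin n → (Fin n → ℤ),
    Function.Injective b ∧
    (∀ i, IsEdge P v (b i)) ∧
    (∀ c : Fin n → ℤ, IsEdge P v c →
      ∃ i, segment ℝ (toR v) (toR c) = segment ℝ (toR v) (toR (b i))) ∧
    IsUnit (Matrix.det (Matrix.of fun i => primVec (b i - v)))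

/-- `P` is a full-dimensional smooth lattice polytope. -/
def IsSmoothPolytope {n : ℕ} (P : Set (Fin n → ℝ)) : Prop :=
  IsLatticePolytope P ∧ IsFullDim P ∧
    ∀ v : Fin n → ℤ, IsVertex P (toR v) → SmoothAtVertex P v

/-- Every edge of `P` has lattice length at least `k`. -/
def EdgesAtLeast {n : ℕ} (P : Set (Fin n → ℝ)) (k : ℕ) : Prop :=
  ∀ a b : Fin n → ℤ, IsEdge P a b → k ≤ latticeLength (b - a)

/-- `P` is a Cayley polytope of order `k` with altitude in direction `eᵢ`:
`P ⊆ {x : 0 ≤ xᵢ ≤ k}` and every vertex of `P` has `i`-th coordinate `0` or `k`. -/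
def IsCayley {n : ℕ} (P : Set (Fin n → ℝ)) (k : ℕ) (i : Fin n) : Prop :=
  (∀ x ∈ P, 0 ≤ x i ∧ x i ≤ (k : ℝ)) ∧
  (∀ v : Fin n → ℝ, IsVertex P v → v i = 0 ∨ v i = (k : ℝ))

/-- `P` is canonically positioned: `0` is a vertex and for each `i` there is an
edge of `P` contained in the nonnegative `xᵢ`-coordinate axis. -/
def CanonicallyPositioned {n : ℕ} (P : Set (Fin n → ℝ)) : Prop :=
  IsVertex P 0 ∧
  ∀ i : Fin n, ∃ a b : Fin n → ℤ, IsEdge P a b ∧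
    segment ℝ (toR a) (toR b) ⊆ {x | 0 ≤ x i ∧ ∀ j, j ≠ i → x j = 0}

/-- `F` is a facet of `P`: an exposed face of dimension `n - 1`. -/
def IsFacet {n : ℕ} (P F : Set (Fin n → ℝ)) : Prop :=
  IsExposed ℝ P F ∧ Module.finrank ℝ (affineSpan ℝ F).direction = n - 1

/-- The lattice width of `Q`: the minimum over nonzero integer functionals `φ` of
`max_{x ∈ Q} ⟨φ, x⟩ - min_{x ∈ Q} ⟨φ, x⟩`. -/
noncomputable def latticeWidth {n : ℕ} (Q : Set (Fin n → ℝ)) : ℝ :=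
  ⨅ φ : {φ : Fin n → ℤ // φ ≠ 0},
    (sSup ((fun x => ∑ i, (φ.1 i : ℝ) * x i) '' Q) -
      sInf ((fun x => ∑ i, (φ.1 i : ℝ) * x i) '' Q))

/-- Embedding of `ℝ^m` into `ℝ^(m+1)` at height `c`. -/
def embR {m : ℕ} (c : ℝ) (x : Fin m → ℝ) : Fin (m + 1) → ℝ := Fin.snoc x c

/-- A (not necessarily lattice) polytope: the convex hull of a finite set. -/
def IsRPolytope {n : ℕ} (P : Set (Fin n → ℝ)) : Prop :=
  ∃ S : Finset (Fin n → ℝ), P = convexHull ℝ (S : Set (Fin n → ℝ))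

/-- The segment from `a` to `b` (distinct points) is an edge of `P`. -/
def REdge {n : ℕ} (P : Set (Fin n → ℝ)) (a b : Fin n → ℝ) : Prop :=
  a ≠ b ∧ IsExposed ℝ P (segment ℝ a b)

/-- A full-dimensional polytope in `ℝⁿ` is simple if every vertex lies on exactly `n`
edges. -/
def IsSimplePolytope {n : ℕ} (P : Set (Fin n → ℝ)) : Prop :=
  ∀ v ∈ Set.extremePoints ℝ P,
    {E : Set (Fin n → ℝ) | ∃ b, REdge P v b ∧ E = segment ℝ v b}.ncard = n

theorem Convex.sep_le_and_imp {E : Type*} [AddCommGroup E] [Module ℝ E] {C : Set E}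
    (hC : Convex ℝ C) (g : E →ₗ[ℝ] ℝ) (r : ℝ) :
    Convex ℝ {x | g x ≤ r ∧ (g x = r → x ∈ C)} := by
  rintro x ⟨hx, hx'⟩ y ⟨hy, hy'⟩ a b ha hb hab
  have hg : g (a • x + b • y) = a * g x + b * g y := by simp
  have hr : r = a * r + b * r := by rw [← add_mul, hab, one_mul]
  have hax := mul_le_mul_of_nonneg_left hx ha
  have hby := mul_le_mul_of_nonneg_left hy hb
  refine ⟨by rw [hg]; linarith, fun h => ?_⟩
  rw [hg] at h
  rcases ha.eq_or_lt with rfl | ha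
  · obtain rfl : b = 1 := by linarith
    simpa using hy' (by linarith)
  rcases hb.eq_or_lt with rfl | hb
  · obtain rfl : a = 1 := by linarith
    simpa using hx' (by linarith)
  exact hC (hx' (mul_left_cancel₀ ha.ne' (by linarith)))
    (hy' (mul_left_cancel₀ hb.ne' (by linarith))) ha.le hb.le hab

theorem right_mem_extremePoints_segment {E : Type*} [AddCommGroup E] [Module ℝ E] (a b : E) :
    b ∈ extremePoints ℝ (segment ℝ a b) := by
  rcases eq_or_ne a b with rfl | hab
  · simp
  rw [mem_extremePoints_iff_left]
  refine ⟨right_mem_segment ℝ a b, ?_⟩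
  rw [segment_eq_image_lineMap]
  rintro _ ⟨s, hs, rfl⟩ _ ⟨t, ht, rfl⟩ ⟨α, β, hα, hβ, hαβ, h⟩
  have h2 : (1 - α * s - β * t) • (b - a) = 0 := by
    obtain rfl : β = 1 - α := by linarith
    rw [AffineMap.lineMap_apply_module, AffineMap.lineMap_apply_module] at h
    rw [← sub_eq_zero.2 h.symm]
    module
  have h3 : 1 - α * s - β * t = 0 :=
    (smul_eq_zero.1 h2).resolve_right (sub_ne_zero.2 hab.symm)
  have h4 : s = 1 := by nlinarith [hs.2, ht.2]
  simp [h4]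

theorem segment_right_injective {E : Type*} [AddCommGroup E] [Module ℝ E] (a : E) :
    Function.Injective (segment ℝ a) := by
  suffices h : ∀ b c : E, segment ℝ a b = segment ℝ a c → b ≠ a → b = c by
    intro b c hbc
    by_cases hb : b = a
    · by_cases hc : c = a
      · rw [hb, hc]
      · exact (h c b hbc.symm hc).symm
    · exact h b c hbc hb
  intro b c hbc hba
  have hb := right_mem_extremePoints_segment a b
  rw [hbc, ← convexHull_pair] at hb
  rcases extremePoints_convexHull_subset hb with h | h
  exacts [absurd h hba, h]

theorem Set.Finite.exists_forall_lt_of_notMem_convexHull {E : Type*} [NormedAddCommGroup E]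
    [NormedSpace ℝ E] {T : Set E} (hT : T.Finite) {p : E} (hp : p ∉ convexHull ℝ T) :
    ∃ f : StrongDual ℝ E, ∀ t ∈ T, f t < f p := by
  obtain ⟨f, u, hu, hfp⟩ := geometric_hahn_banach_closed_point (convex_convexHull ℝ T)
    (hT.isClosed_convexHull ℝ) hp
  exact ⟨f, fun t ht => (hu t (subset_convexHull ℝ T ht)).trans hfp⟩

theorem Set.Finite.convexHull_extremePoints {E : Type*} [NormedAddCommGroup E]
    [NormedSpace ℝ E] {T : Set E} (hT : T.Finite) :
    convexHull ℝ (extremePoints ℝ (convexHull ℝ T)) = convexHull ℝ T := by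
  rw [← ((hT.subset extremePoints_convexHull_subset).isClosed_convexHull ℝ).closure_eq,
    closure_convexHull_extremePoints (hT.isCompact_convexHull ℝ) (convex_convexHull ℝ T)]

theorem notMem_convexHull_diff_of_mem_extremePoints {E : Type*} [AddCommGroup E] [Module ℝ E]
    {T : Set E} {p : E} (hp : p ∈ extremePoints ℝ (convexHull ℝ T)) :
    p ∉ convexHull ℝ (T \ {p}) := fun h =>
  (((convex_convexHull ℝ T).mem_extremePoints_iff_mem_sdiff_convexHull_sdiff).1 hp).2
    (convexHull_mono (sdiff_subset_sdiff_left (subset_convexHull ℝ T)) h)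

/-- The cone of a polytope at a vertex is generated by the edges through this vertex. -/
theorem sub_mem_of_edges_mem {E : Type*} [NormedAddCommGroup E] [NormedSpace ℝ E]
    {S : Set E} (hS : S.Finite) {v : E} (hv : v ∈ extremePoints ℝ (convexHull ℝ S))
    (K : PointedCone ℝ E)
    (hK : ∀ b, v ≠ b → IsExposed ℝ (convexHull ℝ S) (segment ℝ v b) → b - v ∈ K)
    {x : E} (hx : x ∈ convexHull ℝ S) : x - v ∈ K := by
  have hvS : v ∈ S := extremePoints_convexHull_subset hv
  obtain ⟨f₀, hf₀⟩ := (hS.subset sdiff_subset).exists_forall_lt_of_notMem_convexHull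
    (notMem_convexHull_diff_of_mem_extremePoints hv)
  let ℓ : StrongDual ℝ E := -f₀
  have hℓ : ∀ s ∈ S \ {v}, 0 < ℓ (s - v) := fun s hs => by
    have := hf₀ s hs
    simp only [ℓ, neg_apply, map_sub]
    linarith
  let q : E → E := fun s => (ℓ (s - v))⁻¹ • (s - v)
  have hqs : ∀ s ∈ S \ {v}, s - v = ℓ (s - v) • q s := fun s hs => by
    simp only [q, smul_smul, mul_inv_cancel₀ (hℓ s hs).ne', one_smul]
  have hT : (q '' (S \ {v})).Finite := (hS.subset sdiff_subset).image q
  have hext : extremePoints ℝ (convexHull ℝ (q '' (S \ {v}))) ⊆ (K : Set E) := by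
    intro e he
    obtain ⟨f, hf⟩ := (hT.subset sdiff_subset).exists_forall_lt_of_notMem_convexHull
      (notMem_convexHull_diff_of_mem_extremePoints he)
    obtain ⟨b₀, hb₀, hqb₀⟩ := extremePoints_convexHull_subset he
    obtain ⟨b, ⟨hb, hqb⟩, hmax⟩ := Set.exists_max_image {s ∈ S \ {v} | q s = e}
      (fun s => ℓ (s - v)) ((hS.subset sdiff_subset).subset (sep_subset _ _)) ⟨b₀, hb₀, hqb₀⟩
    let g : StrongDual ℝ E := f - f e • ℓ
    have hg : ∀ s ∈ S \ {v}, g s = g v + ℓ (s - v) * (f (q s) - f e) := fun s hs => by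
      have h1 : f (s - v) = ℓ (s - v) * f (q s) := by
        conv_lhs => rw [hqs s hs]
        simp
      have h2 : g s - g v = f (s - v) - f e * ℓ (s - v) := by
        rw [← map_sub]; simp [g]
      rw [h1] at h2
      linarith
    have hgb : g b = g v := by rw [hg b hb, hqb]; ring
    have hP : convexHull ℝ S ⊆
        {x | (g : E →ₗ[ℝ] ℝ) x ≤ g v ∧ ((g : E →ₗ[ℝ] ℝ) x = g v → x ∈ segment ℝ v b)} := by
      refine convexHull_min (fun s hs => ?_) ((convex_segment v b).sep_le_and_imp _ _)
      by_cases hsv : s = v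
      · subst hsv
        exact ⟨le_rfl, fun _ => left_mem_segment ℝ _ _⟩
      have hs' : s ∈ S \ {v} := ⟨hs, hsv⟩
      by_cases hse : q s = e
      · have hle := hmax s ⟨hs', hse⟩
        have hpos := hℓ b hb
        refine ⟨by simp [hg s hs', hse], fun _ => ?_⟩
        rw [segment_eq_image_lineMap]
        refine ⟨ℓ (s - v) / ℓ (b - v), ⟨(div_pos (hℓ s hs') hpos).le, (div_le_one hpos).2 hle⟩, ?_⟩
        rw [AffineMap.lineMap_apply, vsub_eq_sub, vadd_eq_add, hqs b hb, hqb, map_smul,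
          ← hqb, smul_smul]
        have h1 : ℓ (q b) = 1 := by
          simp [q, -map_sub, inv_mul_cancel₀ hpos.ne']
        rw [h1, smul_eq_mul, mul_one, div_mul_cancel₀ _ hpos.ne', hqb, ← hse, ← hqs s hs']
        simp
      · have hlt := mul_neg_of_pos_of_neg (hℓ s hs')
          (sub_neg.2 (hf (q s) ⟨mem_image_of_mem q hs', hse⟩))
        have : g s < g v := by rw [hg s hs']; linarith
        exact ⟨this.le, fun h => absurd h this.ne⟩
    have hvP := subset_convexHull ℝ S hvS
    have hbP := subset_convexHull ℝ S hb.1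
    have hedge : IsExposed ℝ (convexHull ℝ S) (segment ℝ v b) := by
      refine fun _ => ⟨g, Subset.antisymm (fun x hx => ?_) fun x hx => ?_⟩
      · refine ⟨(convex_convexHull ℝ S).segment_subset hvP hbP hx, fun y hy => ?_⟩
        obtain ⟨α, β, _, _, hαβ, rfl⟩ := hx
        rw [map_add, map_smul, map_smul, hgb, ← add_smul, hαβ, one_smul]
        exact (hP hy).1
      · exact (hP hx.1).2 (le_antisymm (hP hx.1).1 (hx.2 v hvP))
    have := K.smul_mem (inv_pos.2 (hℓ b hb)).le
      (hK b (fun h => hb.2 h.symm) hedge)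
    rw [← hqb]
    exact this
  have hQ : convexHull ℝ (q '' (S \ {v})) ⊆ (K : Set E) := by
    rw [← hT.convexHull_extremePoints]
    exact convexHull_min hext (PointedCone.toConvexCone K).convex
  have hSK : convexHull ℝ S ⊆ (fun x => x - v) ⁻¹' (K : Set E) := by
    refine convexHull_min (fun s hs => ?_) ?_
    · by_cases hsv : s = v
      · simp [hsv]
      have hs' : s ∈ S \ {v} := ⟨hs, hsv⟩
      have := K.smul_mem (hℓ s hs').le
        (hQ (subset_convexHull ℝ _ (mem_image_of_mem q hs')))
      rw [mem_preimage, hqs s hs']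
      exact this
    · simp only [sub_eq_add_neg]
      exact (PointedCone.toConvexCone K).convex.translate_preimage_left (-v)
  exact hSK hx

/-- The pointed cone of points where `g` is nonnegative and which lie in `W` when `g` vanishes. -/
def nonnegCone {E : Type*} [AddCommGroup E] [Module ℝ E] (g : E →ₗ[ℝ] ℝ) (W : Submodule ℝ E) :
    PointedCone ℝ E where
  carrier := {x | 0 ≤ g x ∧ (g x = 0 → x ∈ W)}
  zero_mem' := by simp
  add_mem' := by
    rintro x y ⟨hx, hx'⟩ ⟨hy, hy'⟩
    refine ⟨by rw [map_add]; positivity, fun h => ?_⟩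
    rw [map_add] at h
    exact W.add_mem (hx' (by linarith)) (hy' (by linarith))
  smul_mem' := by
    rintro ⟨c, hc⟩ x ⟨hx, hx'⟩
    have hg : g (c • x) = c * g x := by simp
    change 0 ≤ g (c • x) ∧ (g (c • x) = 0 → c • x ∈ W)
    refine ⟨by rw [hg]; positivity, fun h => ?_⟩
    rw [hg, mul_eq_zero] at h
    rcases h with rfl | h
    · simp
    · exact W.smul_mem c (hx' h)

/-- `embR` as an affine map. -/
def embRAffine {m : ℕ} (c : ℝ) : (Fin m → ℝ) →ᵃ[ℝ] (Fin (m + 1) → ℝ) where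
  toFun := embR c
  linear :=
    { toFun := embR 0
      map_add' := fun x y => by
        ext i; refine Fin.lastCases ?_ (fun j => ?_) i <;> simp [embR]
      map_smul' := fun r x => by
        ext i; refine Fin.lastCases ?_ (fun j => ?_) i <;> simp [embR] }
  map_vadd' := fun x y => by
    ext i; refine Fin.lastCases ?_ (fun j => ?_) i <;> simp [embR]

theorem embR_last {m : ℕ} (c : ℝ) (x : Fin m → ℝ) : embR c x (Fin.last m) = c := by
  simp [embR]

theorem embR_injective {m : ℕ} (c : ℝ) : Function.Injective (embR (m := m) c) := fun x y h => by
  simpa [embR] using congrArg Fin.init h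

theorem Convex.embR_image {m : ℕ} {P : Set (Fin m → ℝ)} (hP : Convex ℝ P) (c : ℝ) :
    Convex ℝ (embR c '' P) :=
  hP.affine_image (embRAffine c)

theorem embR_image_convexHull {m : ℕ} (c : ℝ) (S : Set (Fin m → ℝ)) :
    embR c '' convexHull ℝ S = convexHull ℝ (embR c '' S) :=
  (embRAffine c).image_convexHull S

theorem IsRPolytope.convex {n : ℕ} {P : Set (Fin n → ℝ)} (hP : IsRPolytope P) : Convex ℝ P := by
  obtain ⟨S, rfl⟩ := hP
  exact convex_convexHull ℝ _

theorem IsFullDim.nonempty {n : ℕ} {P : Set (Fin n → ℝ)} (hP : IsFullDim P) : P.Nonempty := by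
  rw [← affineSpan_nonempty ℝ, hP]
  exact univ_nonempty

theorem IsRPolytope.exists_finite_convexHull_union {m : ℕ} {P₀ P₁ : Set (Fin m → ℝ)}
    (h0 : IsRPolytope P₀) (h1 : IsRPolytope P₁) (c c' : ℝ) :
    ∃ S : Set (Fin (m + 1) → ℝ), S.Finite ∧ S ⊆ embR c '' P₀ ∪ embR c' '' P₁ ∧
      convexHull ℝ (embR c '' P₀ ∪ embR c' '' P₁) = convexHull ℝ S := by
  obtain ⟨S, rfl⟩ := h0
  obtain ⟨T, rfl⟩ := h1
  refine ⟨embR c '' S ∪ embR c' '' T, (S.finite_toSet.image _).union (T.finite_toSet.image _),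
    union_subset_union (image_mono (subset_convexHull ℝ _)) (image_mono (subset_convexHull ℝ _)),
    ?_⟩
  rw [embR_image_convexHull, embR_image_convexHull, convexHull_convexHull_union_left,
    convexHull_convexHull_union_right]

/-- The affine function `(x_last - c) / (c' - c)`, up to its constant term. -/
noncomputable def layerHeight (m : ℕ) (c c' : ℝ) : (Fin (m + 1) → ℝ) →ₗ[ℝ] ℝ :=
  (c' - c)⁻¹ • LinearMap.proj (Fin.last m)

theorem layerHeight_sub_left {m : ℕ} (c c' : ℝ) (x y : Fin m → ℝ) :
    layerHeight m c c' (embR c x - embR c y) = 0 := by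
  simp [layerHeight, embR_last]

theorem layerHeight_sub_right {m : ℕ} {c c' : ℝ} (hc : c ≠ c') (x y : Fin m → ℝ) :
    layerHeight m c c' (embR c' x - embR c y) = 1 := by
  simp [layerHeight, embR_last, inv_mul_cancel₀ (sub_ne_zero.2 hc.symm)]

theorem isExtreme_layer {m : ℕ} {c c' : ℝ} (hc : c ≠ c') {P₀ P₁ : Set (Fin m → ℝ)}
    (h0 : Convex ℝ P₀) :
    IsExtreme ℝ (convexHull ℝ (embR c '' P₀ ∪ embR c' '' P₁)) (embR c '' P₀) := by
  refine ⟨subset_union_left.trans (subset_convexHull ℝ _), ?_⟩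
  have hP : convexHull ℝ (embR c '' P₀ ∪ embR c' '' P₁) ⊆
      {x | (-layerHeight m c c') x ≤ (-layerHeight m c c') (embR c 0) ∧
        ((-layerHeight m c c') x = (-layerHeight m c c') (embR c 0) → x ∈ embR c '' P₀)} := by
    refine convexHull_min ?_ ((h0.embR_image c).sep_le_and_imp _ _)
    rintro _ (⟨x, hx, rfl⟩ | ⟨x, hx, rfl⟩)
    · have := layerHeight_sub_left c c' x 0
      rw [map_sub] at this
      simp only [LinearMap.neg_apply, mem_ofPred_eq]
      exact ⟨by linarith, fun _ => mem_image_of_mem _ hx⟩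
    · have := layerHeight_sub_right hc x 0
      rw [map_sub] at this
      simp only [LinearMap.neg_apply, mem_ofPred_eq]
      exact ⟨by linarith, fun h => by linarith⟩
  rintro x hx y hy _ ⟨z, hz, rfl⟩ ⟨α, β, hα, hβ, hαβ, h⟩
  have hz' := layerHeight_sub_left c c' z 0
  rw [map_sub, ← h, map_add, map_smul, map_smul] at hz'
  have h1 := (hP hx).1
  have h2 := (hP hy).1
  refine (hP hx).2 (le_antisymm h1 ?_)
  simp only [LinearMap.neg_apply, smul_eq_mul] at h1 h2 hz' ⊢
  obtain rfl : β = 1 - α := by linarith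
  nlinarith

theorem REdge.right_mem_extremePoints {n : ℕ} {P : Set (Fin n → ℝ)} {a b : Fin n → ℝ}
    (h : REdge P a b) : b ∈ extremePoints ℝ P :=
  h.2.isExtreme.extremePoints_subset_extremePoints (right_mem_extremePoints_segment a b)

theorem REdge.symm {n : ℕ} {P : Set (Fin n → ℝ)} {a b : Fin n → ℝ} (h : REdge P a b) :
    REdge P b a :=
  ⟨h.1.symm, segment_symm ℝ a b ▸ h.2⟩

theorem IsSimplePolytope.ncard_edge_endpoints {n : ℕ} {P : Set (Fin n → ℝ)}
    (hP : IsSimplePolytope P) {v : Fin n → ℝ} (hv : v ∈ extremePoints ℝ P) :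
    {b | REdge P v b}.ncard = n := by
  refine Eq.trans ?_ (hP v hv)
  rw [← ncard_image_of_injective _ (segment_right_injective v)]
  congr 1
  ext E
  simp [eq_comm]

theorem existsUnique_edge_to_other_layer {m : ℕ} {c c' : ℝ} (hc : c ≠ c')
    {P₀ P₁ : Set (Fin m → ℝ)} (h0 : IsRPolytope P₀) (h1 : IsRPolytope P₁)
    (h0d : IsFullDim P₀) (h1n : P₁.Nonempty)
    (hsimple : IsSimplePolytope (convexHull ℝ (embR c '' P₀ ∪ embR c' '' P₁)))
    {v : Fin (m + 1) → ℝ} (hv : v ∈ extremePoints ℝ (embR c '' P₀)) :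
    ∃! b, b ∈ embR c' '' P₁ ∧ REdge (convexHull ℝ (embR c '' P₀ ∪ embR c' '' P₁)) v b := by
  have hvP := (isExtreme_layer (P₁ := P₁) hc h0.convex).extremePoints_subset_extremePoints hv
  have hcard := hsimple.ncard_edge_endpoints hvP
  obtain ⟨S, hS, hSsub, hPS⟩ := h0.exists_finite_convexHull_union h1 c c'
  set P := convexHull ℝ (embR c '' P₀ ∪ embR c' '' P₁) with hP
  obtain ⟨v₀, hv₀, rfl⟩ := extremePoints_subset hv
  set N₀ := {b | b ∈ embR c '' P₀ ∧ REdge P (embR c v₀) b} with hN₀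
  set N₁ := {b | b ∈ embR c' '' P₁ ∧ REdge P (embR c v₀) b} with hN₁
  have hN : {b | REdge P (embR c v₀) b} = N₀ ∪ N₁ := by
    ext b
    refine ⟨fun hb => ?_, fun hb => hb.elim And.right And.right⟩
    exact (extremePoints_convexHull_subset hb.right_mem_extremePoints).imp (⟨·, hb⟩) (⟨·, hb⟩)
  have hfin : (N₀ ∪ N₁).Finite := hN ▸ finite_of_ncard_pos (by omega)
  have hdisj : Disjoint N₀ N₁ := by
    rw [Set.disjoint_left]
    rintro _ ⟨⟨x, _, rfl⟩, _⟩ ⟨⟨y, _, hy⟩, _⟩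
    have := congrFun hy (Fin.last m)
    rw [embR_last, embR_last] at this
    exact hc this.symm
  rw [hN, ncard_union_eq hdisj (hfin.subset subset_union_left) (hfin.subset subset_union_right)]
    at hcard
  have key : ∀ x ∈ P, x - embR c v₀ ∈ nonnegCone (layerHeight m c c')
      (Submodule.span ℝ ((fun b => b - embR c v₀) '' N₀)) := by
    intro x hx
    rw [hPS] at hx hvP
    refine sub_mem_of_edges_mem hS hvP _ (fun b hvb hb => ?_) hx
    rw [← hPS] at hb
    rcases hN.subset (⟨hvb, hb⟩ : REdge P (embR c v₀) b) with hb | hb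
    · have hmem := Submodule.subset_span (R := ℝ)
        (mem_image_of_mem (fun b => b - embR c v₀) hb)
      obtain ⟨y, hy, rfl⟩ := hb.1
      exact ⟨(layerHeight_sub_left c c' y v₀).ge, fun _ => hmem⟩
    · obtain ⟨y, hy, rfl⟩ := hb.1
      have := layerHeight_sub_right hc y v₀
      exact ⟨by rw [this]; exact zero_le_one, fun h => by rw [this] at h; simp at h⟩
  have hle₀ : m ≤ N₀.ncard := by
    let π : (Fin (m + 1) → ℝ) →ₗ[ℝ] (Fin m → ℝ) := LinearMap.funLeft ℝ ℝ Fin.castSucc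
    have hπ : ∀ (r : ℝ) (x : Fin m → ℝ), π (embR r x) = x := fun r x => by
      ext i; simp [π, embR, LinearMap.funLeft_apply]
    have hfinW := (hfin.subset subset_union_left).image fun b => π (b - embR c v₀)
    have hspan : Submodule.span ℝ ((fun b => π (b - embR c v₀)) '' N₀) = ⊤ := by
      have hvs : vectorSpan ℝ P₀ = ⊤ := by
        rw [← direction_affineSpan, h0d, AffineSubspace.direction_top]
      rw [eq_top_iff, ← hvs, vectorSpan_eq_span_vsub_set_right ℝ hv₀, Submodule.span_le]
      rintro _ ⟨x, hx, rfl⟩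
      have hmem := (key (embR c x) (subset_convexHull ℝ _ (Or.inl ⟨x, hx, rfl⟩))).2
        (layerHeight_sub_left c c' x v₀)
      have := Submodule.mem_map_of_mem (f := π) hmem
      rw [Submodule.map_span, image_image, map_sub, hπ, hπ] at this
      exact this
    have := hfinW.fintype
    have hrank := finrank_span_le_card (R := ℝ) ((fun b => π (b - embR c v₀)) '' N₀)
    rw [hspan, finrank_top, Module.finrank_fin_fun, ← ncard_eq_toFinset_card'] at hrank
    exact hrank.trans (ncard_image_le (hfin.subset subset_union_left))
  have hpos₁ : N₁.Nonempty := by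
    by_contra hemp
    rw [not_nonempty_iff_eq_empty] at hemp
    obtain ⟨y, hy⟩ := h1n
    rw [hPS] at hvP
    have := sub_mem_of_edges_mem hS hvP
      (PointedCone.ofSubmodule (LinearMap.ker (layerHeight m c c'))) (fun b hvb hb => ?_)
      (hPS ▸ subset_convexHull ℝ _ (Or.inr ⟨y, hy, rfl⟩) : embR c' y ∈ convexHull ℝ S)
    · have h0 : layerHeight m c c' (embR c' y - embR c v₀) = 0 := this
      rw [layerHeight_sub_right hc] at h0
      exact one_ne_zero h0
    · rw [← hPS] at hb
      have hb' := hN.subset (⟨hvb, hb⟩ : REdge P (embR c v₀) b)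
      rw [hemp, union_empty] at hb'
      obtain ⟨z, hz, rfl⟩ := hb'.1
      exact layerHeight_sub_left c c' z v₀
  have hpos := (ncard_pos (hfin.subset subset_union_right)).2 hpos₁
  obtain ⟨b, hb⟩ := ncard_eq_one.1 (show N₁.ncard = 1 by omega)
  have hbN : b ∈ N₁ := hb ▸ mem_singleton b
  exact ⟨b, hbN, fun b' hb' => (hb.subset hb' : b' ∈ ({b} : Set _))⟩

theorem Set.ncard_eq_of_existsUnique {α β : Type*} {s : Set α} {t : Set β} (r : α → β → Prop)
    (hs : ∀ a ∈ s, ∃! b, b ∈ t ∧ r a b) (ht : ∀ b ∈ t, ∃! a, a ∈ s ∧ r a b) :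
    s.ncard = t.ncard := by
  choose f hf hfu using hs
  refine ncard_congr f (fun a ha => (hf a ha).1) (fun a a' ha ha' h => ?_) fun b hb => ?_
  · exact (ht _ (hf a ha).1).unique ⟨ha, (hf a ha).2⟩ ⟨ha', h ▸ (hf a' ha').2⟩
  · obtain ⟨a, ⟨ha, hab⟩, _⟩ := ht b hb
    exact ⟨a, ha, (hfu a ha b ⟨hb, hab⟩).symm⟩

theorem ncard_extremePoints_embR_image {m : ℕ} (c : ℝ) (P : Set (Fin m → ℝ)) :
    (extremePoints ℝ (embR c '' P)).ncard = (extremePoints ℝ P).ncard := by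
  rw [← ncard_image_of_injective (extremePoints ℝ P) (embR_injective c)]
  refine congrArg ncard ?_
  have hseg : ∀ x y : Fin m → ℝ,
      openSegment ℝ (embR c x) (embR c y) = embR c '' openSegment ℝ x y :=
    fun x y => (image_openSegment ℝ (embRAffine c) x y).symm
  ext z
  simp only [mem_extremePoints_iff_left, mem_image]
  constructor
  · rintro ⟨⟨x, hx, rfl⟩, h⟩
    refine ⟨x, ⟨hx, fun y hy w hw hxyw => embR_injective c ?_⟩, rfl⟩
    exact h _ ⟨y, hy, rfl⟩ _ ⟨w, hw, rfl⟩ (hseg y w ▸ mem_image_of_mem _ hxyw)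
  · rintro ⟨x, ⟨hx, h⟩, rfl⟩
    refine ⟨⟨x, hx, rfl⟩, ?_⟩
    rintro _ ⟨y, hy, rfl⟩ _ ⟨w, hw, rfl⟩ hxyw
    rw [hseg] at hxyw
    rw [h y hy w hw ((embR_injective c).mem_set_image.1 hxyw)]

/-- Let `P₀, P₁ ⊂ ℝ^(n-1)` be `(n-1)`-dimensional polytopes and let
`P = conv((P₀ × {0}) ∪ (P₁ × {k})) ⊂ ℝⁿ` be full-dimensional and simple (here
`n = m + 1`). Then every vertex of `P` lies in `P₀ × {0}` or `P₁ × {k}`, every vertex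
of `P₀ × {0}` lies on exactly one edge of `P` with other endpoint in `P₁ × {k}` and
symmetrically; consequently `P₀` and `P₁` have the same number of vertices. -/
theorem stmt_13 {m k : ℕ} (hk : 1 ≤ k) (P₀ P₁ : Set (Fin m → ℝ))
    (h0 : IsRPolytope P₀) (h1 : IsRPolytope P₁)
    (h0d : IsFullDim P₀) (h1d : IsFullDim P₁)
    (hfull : IsFullDim (convexHull ℝ (embR 0 '' P₀ ∪ embR (k : ℝ) '' P₁)))
    (hsimple : IsSimplePolytope (convexHull ℝ (embR 0 '' P₀ ∪ embR (k : ℝ) '' P₁))) :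
    (∀ v ∈ Set.extremePoints ℝ (convexHull ℝ (embR 0 '' P₀ ∪ embR (k : ℝ) '' P₁)),
      v ∈ embR (0 : ℝ) '' P₀ ∨ v ∈ embR (k : ℝ) '' P₁) ∧
    (∀ v ∈ Set.extremePoints ℝ (embR (0 : ℝ) '' P₀),
      ∃! b, b ∈ embR (k : ℝ) '' P₁ ∧
        REdge (convexHull ℝ (embR 0 '' P₀ ∪ embR (k : ℝ) '' P₁)) v b) ∧
    (∀ v ∈ Set.extremePoints ℝ (embR (k : ℝ) '' P₁),
      ∃! b, b ∈ embR (0 : ℝ) '' P₀ ∧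
        REdge (convexHull ℝ (embR 0 '' P₀ ∪ embR (k : ℝ) '' P₁)) v b) ∧
    (Set.extremePoints ℝ P₀).ncard = (Set.extremePoints ℝ P₁).ncard := by
  have hc : (0 : ℝ) ≠ k := by
    have : (k : ℝ) ≠ 0 := by exact_mod_cast (by omega : k ≠ 0)
    exact this.symm
  have up : ∀ v ∈ Set.extremePoints ℝ (embR (0 : ℝ) '' P₀),
      ∃! b, b ∈ embR (k : ℝ) '' P₁ ∧
        REdge (convexHull ℝ (embR 0 '' P₀ ∪ embR (k : ℝ) '' P₁)) v b := fun v hv =>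
    existsUnique_edge_to_other_layer hc h0 h1 h0d h1d.nonempty hsimple hv
  have down : ∀ v ∈ Set.extremePoints ℝ (embR (k : ℝ) '' P₁),
      ∃! b, b ∈ embR (0 : ℝ) '' P₀ ∧
        REdge (convexHull ℝ (embR 0 '' P₀ ∪ embR (k : ℝ) '' P₁)) v b := fun v hv => by
    rw [union_comm] at hsimple ⊢
    exact existsUnique_edge_to_other_layer hc.symm h1 h0 h1d h0d.nonempty hsimple hv
  refine ⟨fun _ hv => (mem_union _ _ _).1 (extremePoints_convexHull_subset hv), up, down, ?_⟩
  rw [← ncard_extremePoints_embR_image 0 P₀, ← ncard_extremePoints_embR_image (k : ℝ) P₁]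
  refine Set.ncard_eq_of_existsUnique
    (REdge (convexHull ℝ (embR 0 '' P₀ ∪ embR (k : ℝ) '' P₁))) (fun v hv => ?_) fun v hv => ?_
  · obtain ⟨b, ⟨hb, hvb⟩, huniq⟩ := up v hv
    refine ⟨b, ⟨?_, hvb⟩, fun b' hb' => huniq b' ⟨extremePoints_subset hb'.1, hb'.2⟩⟩
    exact inter_extremePoints_subset_extremePoints_of_subset
      (subset_union_right.trans (subset_convexHull ℝ _)) ⟨hb, hvb.right_mem_extremePoints⟩
  · obtain ⟨b, ⟨hb, hvb⟩, huniq⟩ := down v hv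
    refine ⟨b, ⟨?_, hvb.symm⟩, fun b' hb' => huniq b' ⟨extremePoints_subset hb'.1, hb'.2.symm⟩⟩
    exact inter_extremePoints_subset_extremePoints_of_subset
      (subset_union_left.trans (subset_convexHull ℝ _)) ⟨hb, hvb.right_mem_extremePoints⟩
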